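/- arXiv:2603.02782 — 2 statements merged into one kernel-verified Lean document; each statement's English description precedes it below -/
import Mathlib

section
/- Let f : ℝ^d → ℝ be C² with L-Lipschitz gradient, ∇f(0) = 0, and fix α_max < 1/L. Then for every c > 0 there exists r > 0 such that for all α ∈ (0, α_max], the proximal point map g_α (the unique minimizer map g_α(x) = argmin_z f(z) + ‖z−x‖²/(2α)) satisfies Lip((g_α − Dg_α(0))|_{B_r(0)}) ≤ c·α. -/
section ProximalPoint

open Topology InnerProductSpace

variable {E : Type*} [NormedAddCommGroup E] [InnerProductSpace ℝ E]

/-- The optimality condition of the proximal problem: `z + α ∇f(z) = x`. -/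
theorem add_smul_gradient_eq_of_isLocalMin [CompleteSpace E] {f : E → ℝ} {α : ℝ} (hα : 0 < α)
    {x z : E} (hf : DifferentiableAt ℝ f z)
    (hmin : IsLocalMin (fun w => f w + ‖w - x‖ ^ 2 / (2 * α)) z) :
    z + α • gradient f z = x := by
  have hsq : HasFDerivAt (fun w : E => ‖w - x‖ ^ 2) _ z := ((hasFDerivAt_id z).sub_const x).norm_sq
  have hzero := hmin.hasFDerivAt_eq_zero
    (hf.hasGradientAt.hasFDerivAt.add (hsq.mul_const (2 * α)⁻¹))
  set v := z + α • gradient f z - x with hv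
  have hdir := DFunLike.congr_fun hzero v
  simp at hdir
  have hself : inner ℝ v v = (0 : ℝ) := by
    have hsplit : v = α • gradient f z + (z - x) := by rw [hv]; abel
    have hexp : inner ℝ v v = α * inner ℝ (gradient f z) v + inner ℝ (z - x) v := by
      conv_lhs => rw [hsplit, inner_add_left, real_inner_smul_left, ← hsplit]
    have hgrad : inner ℝ (gradient f z) v = fderiv ℝ f z v := by simp [gradient]
    rw [hexp, hgrad, inner_sub_left]
    field_simp at hdir
    linarith
  exact sub_eq_zero.mp (inner_self_eq_zero.mp hself)

theorem ContDiff.gradient [CompleteSpace E] {f : E → ℝ} (hf : ContDiff ℝ 2 f) :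
    ContDiff ℝ 1 (gradient f) :=
  (toDual ℝ E).symm.toContinuousLinearEquiv.contDiff.comp
    (hf.fderiv_right (m := 1) (by norm_num))

/-- A perturbation of the identity with modulus `L` expands distances by at least `1 - α L`. -/
theorem mul_norm_le_norm_add_smul {α β L : ℝ} (hα : 0 ≤ α) (hαβ : α ≤ β) (hL : 0 ≤ L)
    {u v : E} (hv : ‖v‖ ≤ L * ‖u‖) : (1 - β * L) * ‖u‖ ≤ ‖u + α • v‖ := by
  have htri : ‖u‖ ≤ ‖u + α • v‖ + ‖α • v‖ := by
    simpa using norm_sub_le (u + α • v) (α • v)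
  rw [norm_smul, Real.norm_of_nonneg hα] at htri
  have h₁ : α * ‖v‖ ≤ α * (L * ‖u‖) := by gcongr
  have h₂ : α * (L * ‖u‖) ≤ β * (L * ‖u‖) := by gcongr
  linarith

end ProximalPoint


/-- Local Lipschitz control for the proximal point maps: for `f : ℝ^d → ℝ` of class `C²`
with `L`-Lipschitz gradient, `∇f(0) = 0` and `α_max < 1/L`, for every `c > 0` there is
`r > 0` such that for all `α ∈ (0, α_max]`, the proximal map `g_α` (the unique-minimizer
map of `z ↦ f(z) + ‖z−x‖²/(2α)`) satisfies
`Lip((g_α − Dg_α(0))|_{B_r(0)}) ≤ c·α`, where `Dg_α(0) = (I + α ∇²f(0))⁻¹`. -/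
theorem pp_local_lipschitz_control {d : ℕ}
    (f : EuclideanSpace ℝ (Fin d) → ℝ) (hf : ContDiff ℝ 2 f)
    (L : ℝ) (hL : 0 < L) (hlip : LipschitzWith (Real.toNNReal L) (gradient f))
    (hgrad0 : gradient f 0 = 0)
    (αmax : ℝ) (hαmax0 : 0 < αmax) (hαmax : αmax < 1 / L)
    (g : ℝ → EuclideanSpace ℝ (Fin d) → EuclideanSpace ℝ (Fin d))
    (hargmin : ∀ α, 0 < α → α ≤ αmax → ∀ x z, z ≠ g α x →
      f (g α x) + ‖g α x - x‖ ^ 2 / (2 * α) < f z + ‖z - x‖ ^ 2 / (2 * α)) :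
    ∀ c > (0:ℝ), ∃ r > (0:ℝ), ∀ α, 0 < α → α ≤ αmax →
      ∀ A : EuclideanSpace ℝ (Fin d) →L[ℝ] EuclideanSpace ℝ (Fin d),
        ((ContinuousLinearMap.id ℝ (EuclideanSpace ℝ (Fin d))
            + α • fderiv ℝ (gradient f) 0).comp A
          = ContinuousLinearMap.id ℝ (EuclideanSpace ℝ (Fin d)) ∧
         A.comp (ContinuousLinearMap.id ℝ (EuclideanSpace ℝ (Fin d))
            + α • fderiv ℝ (gradient f) 0)
          = ContinuousLinearMap.id ℝ (EuclideanSpace ℝ (Fin d))) →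
      ∀ x ∈ Metric.ball (0 : EuclideanSpace ℝ (Fin d)) r,
      ∀ y ∈ Metric.ball (0 : EuclideanSpace ℝ (Fin d)) r,
        ‖(g α x - A x) - (g α y - A y)‖ ≤ (c * α) * ‖x - y‖ := by
  intro c hc
  set H := fderiv ℝ (gradient f) 0 with hH
  set k := 1 - αmax * L with hk
  have hk0 : 0 < k := by
    rw [lt_div_iff₀ hL] at hαmax
    linarith
  have hlip' : ∀ z w, ‖gradient f z - gradient f w‖ ≤ L * ‖z - w‖ := fun z w => by
    simpa [Real.coe_toNNReal L hL.le] using hlip.norm_sub_le z w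
  have hHL : ∀ u, ‖H u‖ ≤ L * ‖u‖ := by
    have hnorm : ‖H‖ ≤ L := by
      simpa [Real.coe_toNNReal L hL.le] using norm_fderiv_le_of_lipschitz ℝ hlip (x₀ := 0)
    exact fun u => H.le_of_opNorm_le hnorm u
  have hcrit : ∀ α, 0 < α → α ≤ αmax → ∀ x, g α x + α • gradient f (g α x) = x := by
    intro α hα hαm x
    refine add_smul_gradient_eq_of_isLocalMin hα (hf.differentiable (by norm_num) _)
      (Filter.Eventually.of_forall fun z => ?_)
    rcases eq_or_ne z (g α x) with rfl | hz
    · exact le_rfl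
    · exact (hargmin α hα hαm x z hz).le
  have hgsub : ∀ α, 0 < α → α ≤ αmax → ∀ x y, k * ‖g α x - g α y‖ ≤ ‖x - y‖ := by
    intro α hα hαm x y
    have hexpand := mul_norm_le_norm_add_smul hα.le hαm hL.le (hlip' (g α x) (g α y))
    have hxy : g α x - g α y + α • (gradient f (g α x) - gradient f (g α y)) = x - y := by
      conv_rhs => rw [← hcrit α hα hαm x, ← hcrit α hα hαm y]
      module
    rwa [hxy] at hexpand
  have hg0 : ∀ α, 0 < α → α ≤ αmax → g α 0 = 0 := by
    intro α hα hαm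
    have hexpand := mul_norm_le_norm_add_smul hα.le hαm hL.le (hlip' (g α 0) 0)
    rw [hgrad0, sub_zero, sub_zero, hcrit α hα hαm 0, norm_zero] at hexpand
    exact norm_le_zero_iff.mp (nonpos_of_mul_nonpos_right hexpand hk0)
  have hstrict : HasStrictFDerivAt (gradient f) H 0 :=
    hf.gradient.contDiffAt.hasStrictFDerivAt (by norm_num)
  have hε : 0 < c * k ^ 2 := by positivity
  obtain ⟨s, hs, happrox⟩ := hstrict.approximates_deriv_on_nhds
    (c := ⟨c * k ^ 2, hε.le⟩) (Or.inr (by exact_mod_cast hε))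
  obtain ⟨δ, hδ, hball⟩ := Metric.mem_nhds_iff.mp hs
  refine ⟨k * δ, by positivity, fun α hα hαm A hA x hx y hy => ?_⟩
  have hmem : ∀ x ∈ Metric.ball (0 : EuclideanSpace ℝ (Fin d)) (k * δ), g α x ∈ s := by
    intro x hx
    have hgx := hgsub α hα hαm x 0
    rw [hg0 α hα hαm, sub_zero, sub_zero] at hgx
    rw [mem_ball_zero_iff] at hx
    exact hball (mem_ball_zero_iff.mpr (lt_of_mul_lt_mul_left (hgx.trans_lt hx) hk0.le))
  have hξ : ‖gradient f (g α x) - gradient f (g α y) - H (g α x - g α y)‖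
      ≤ c * k ^ 2 * ‖g α x - g α y‖ := happrox _ (hmem x hx) _ (hmem y hy)
  have hA_apply : ∀ v, A v + α • H (A v) = v := fun v => by
    simpa using DFunLike.congr_fun hA.1 v
  set u := (g α x - A x) - (g α y - A y) with hu
  have hures : u + α • H u
      = -(α • (gradient f (g α x) - gradient f (g α y) - H (g α x - g α y))) := by
    have hx' := (hA_apply x).trans (hcrit α hα hαm x).symm
    have hy' := (hA_apply y).trans (hcrit α hα hαm y).symm
    rw [hu]
    simp only [map_sub]
    linear_combination (norm := module) hy' - hx'
  have hexpand := mul_norm_le_norm_add_smul hα.le hαm hL.le (hHL u)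
  rw [hures, norm_neg, norm_smul, Real.norm_of_nonneg hα.le] at hexpand
  refine le_of_mul_le_mul_left ?_ hk0
  calc k * ‖u‖ ≤ α * (c * k ^ 2 * ‖g α x - g α y‖) :=
        hexpand.trans (mul_le_mul_of_nonneg_left hξ hα.le)
    _ = α * c * k * (k * ‖g α x - g α y‖) := by ring
    _ ≤ α * c * k * ‖x - y‖ := by
        gcongr
        exact hgsub α hα hαm x y
    _ = k * (c * α * ‖x - y‖) := by ring
end

section
/- Let ℝ^d = E_cs ⊕ E_u be a splitting with projectors p_cs, p_u, equipped with the max-norm ‖x‖ = max(‖p_cs(x)‖, ‖p_u(x)‖). Let T be a linear map leaving E_cs and E_u invariant with ‖Ty‖ ≤ λ‖y‖ on E_cs and ‖Tz‖ ≥ μ‖z‖ on E_u, where 1 ≤ λ < μ, and let g satisfy g(0) = 0 and Lip(g − T) ≤ ε < (μ−λ)/4. Let φ : E_cs → E_u satisfy Lip(φ) ≤ 1 and φ(0) = 0, and define h_y^φ(z) = (T|_{E_u})⁻¹(φ(p_cs(g(y+z))) − p_u((g−T)(y+z))). Then for all y ∈ E_cs, z ↦ h_y^φ(z) is (2ε/μ)-Lipschitz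 with 2ε/μ < 1, and for all z ∈ E_u, y ↦ h_y^φ(z) is ((λ+2ε)/μ)-Lipschitz. -/
/-- Auxiliary-map lemma of the graph transform method. With the splitting
`ℝ^d = E_cs ⊕ E_u` (modeled as the product `Ecs × Eu` with the max-norm), a linear map
`T` leaving both factors invariant with `‖Ty‖ ≤ λ‖y‖` on `E_cs` and `‖Tz‖ ≥ μ‖z‖` on
`E_u` (`1 ≤ λ < μ`), `g` with `g 0 = 0` and `Lip(g − T) ≤ ε < (μ−λ)/4`, and
`φ : E_cs → E_u` `1`-Lipschitz with `φ 0 = 0`, the auxiliary map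
`h_y^φ(z) = (T|_{E_u})⁻¹(φ(p_cs(g(y+z))) − p_u((g−T)(y+z)))` is `(2ε/μ)`-Lipschitz in
`z` (with `2ε/μ < 1`) and `((λ+2ε)/μ)`-Lipschitz in `y`. -/
theorem auxiliary_map_lipschitz
    {Ecs Eu : Type*}
    [NormedAddCommGroup Ecs] [NormedSpace ℝ Ecs]
    [NormedAddCommGroup Eu] [NormedSpace ℝ Eu]
    (T : Ecs × Eu →L[ℝ] Ecs × Eu)
    (g : Ecs × Eu → Ecs × Eu)
    (μ lam ε : ℝ) (hlam : 1 ≤ lam) (hlamμ : lam < μ)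
    (hε0 : 0 < ε) (hε : ε < (μ - lam) / 4)
    (hinv_cs : ∀ y : Ecs, (T (y, 0)).2 = 0)
    (hinv_u : ∀ z : Eu, (T (0, z)).1 = 0)
    (hTcs : ∀ y : Ecs, ‖T (y, 0)‖ ≤ lam * ‖y‖)
    (hTu : ∀ z : Eu, μ * ‖z‖ ≤ ‖T (0, z)‖)
    (hg0 : g 0 = 0)
    (hgT : ∀ x x' : Ecs × Eu, ‖(g x - T x) - (g x' - T x')‖ ≤ ε * ‖x - x'‖)
    (S : Eu →L[ℝ] Eu)
    (hS₁ : ∀ z : Eu, S ((T (0, z)).2) = z)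
    (hS₂ : ∀ z : Eu, (T (0, S z)).2 = z)
    (φ : Ecs → Eu) (hφ0 : φ 0 = 0)
    (hφlip : ∀ y y' : Ecs, ‖φ y - φ y'‖ ≤ ‖y - y'‖)
    (h : Ecs → Eu → Eu)
    (hdef : ∀ y z, h y z = S (φ ((g (y, z)).1) - ((g (y, z)).2 - (T (y, z)).2))) :
    (2 * ε / μ < 1) ∧
    (∀ y z₁ z₂, ‖h y z₁ - h y z₂‖ ≤ (2 * ε / μ) * ‖z₁ - z₂‖) ∧
    (∀ z y₁ y₂, ‖h y₁ z - h y₂ z‖ ≤ ((lam + 2 * ε) / μ) * ‖y₁ - y₂‖) := by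
  have hμ : 0 < μ := by linarith
  have hS : ∀ w, μ * ‖S w‖ ≤ ‖w‖ := fun w ↦ by
    have hw : T (0, S w) = (0, w) := Prod.ext (hinv_u _) (hS₂ w)
    have := hTu (S w)
    rwa [hw, Prod.norm_mk, norm_zero, max_eq_right (norm_nonneg w)] at this
  have key : ∀ y y' z z', μ * ‖h y z - h y' z'‖ ≤
      ‖(T (y - y', z - z')).1‖ + 2 * ε * ‖(y - y', z - z')‖ := fun y y' z z' ↦ by
    have hG := hgT (y, z) (y', z')
    rw [Prod.mk_sub_mk y] at hG
    have hG₁ := (norm_fst_le _).trans hG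
    have hG₂ := (norm_snd_le _).trans hG
    simp only [Prod.fst_sub, Prod.snd_sub] at hG₁ hG₂
    have hT : (T (y - y', z - z')).1 = (T (y, z)).1 - (T (y', z')).1 := by
      rw [← Prod.mk_sub_mk, map_sub, Prod.fst_sub]
    have hg₁ : ‖(g (y, z)).1 - (g (y', z')).1‖ ≤
        ‖(T (y - y', z - z')).1‖ + ε * ‖(y - y', z - z')‖ := by
      refine le_trans (le_of_eq ?_) ((norm_add_le _ _).trans (add_le_add_right hG₁ _))
      rw [hT]
      congr 1
      abel
    rw [hdef, hdef, ← map_sub]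
    refine (hS _).trans ?_
    rw [sub_sub_sub_comm]
    refine (norm_sub_le _ _).trans ?_
    linarith [hφlip (g (y, z)).1 (g (y', z')).1]
  refine ⟨by rw [div_lt_one hμ]; linarith, fun y z₁ z₂ ↦ ?_, fun z y₁ y₂ ↦ ?_⟩
  · rw [div_mul_eq_mul_div, le_div_iff₀' hμ]
    simpa [hinv_u, Prod.norm_mk] using key y y z₁ z₂
  · rw [div_mul_eq_mul_div, le_div_iff₀' hμ, add_mul]
    have := key y₁ y₂ z z
    rw [sub_self, Prod.norm_mk, norm_zero, max_eq_left (norm_nonneg _)] at this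
    exact this.trans (add_le_add_left ((norm_fst_le _).trans (hTcs _)) _)
end
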